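/- Let G be a finite nilpotent non-abelian group and let p be the smallest prime divisor of |G|. Then D(G) ≤ ((p² + 2p − 2)/p³)·|G|. -/

import Mathlib

/-- The set of all products of the terms of the multiset `S` taken in some order. -/
def prodSet {G : Type*} [Group G] (S : Multiset G) : Set G :=
  {g | ∃ l : List G, (l : Multiset G) = S ∧ l.prod = g}

/-- A sequence (multiset) over `G` is a product-one sequence if its terms can be
ordered so that their product is `1`. -/
def IsProductOne {G : Type*} [Group G] (S : Multiset G) : Prop :=
  (1 : G) ∈ prodSet S

/-- A minimal product-one sequence (atom): a nontrivial product-one sequence that cannot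
be partitioned into two nontrivial product-one subsequences. -/
def IsMinimalProductOne {G : Type*} [Group G] (S : Multiset G) : Prop :=
  S ≠ 0 ∧ IsProductOne S ∧
    ¬ ∃ T₁ T₂ : Multiset G, T₁ ≠ 0 ∧ T₂ ≠ 0 ∧ S = T₁ + T₂ ∧
      IsProductOne T₁ ∧ IsProductOne T₂

/-- The small Davenport constant: the maximal length of a sequence over `G` having
no nontrivial product-one subsequence. -/
noncomputable def smallDavenport (G : Type*) [Group G] : ℕ :=
  sSup {n | ∃ S : Multiset G, Multiset.card S = n ∧
    ∀ T : Multiset G, T ≤ S → T ≠ 0 → ¬ IsProductOne T}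

/-- The large Davenport constant: the maximal length of a minimal product-one sequence. -/
noncomputable def largeDavenport (G : Type*) [Group G] : ℕ :=
  sSup {n | ∃ S : Multiset G, Multiset.card S = n ∧ IsMinimalProductOne S}

section General

variable {G : Type*} [Group G]

theorem IsMinimalProductOne.not_split {S : Multiset G} (h : IsMinimalProductOne S)
    {l₁ l₂ : List G} (h₁ : l₁ ≠ []) (h₂ : l₂ ≠ []) (hS : S = (l₁ ++ l₂ : List G))
    (p₁ : l₁.prod = 1) (p₂ : l₂.prod = 1) : False :=
  h.2.2 ⟨l₁, l₂, by simpa using h₁, by simpa using h₂, by simpa using hS,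
    ⟨l₁, rfl, p₁⟩, ⟨l₂, rfl, p₂⟩⟩

/-- A list of length at least `|A|` over a finite subgroup `A` has a nonempty block of
consecutive terms with product one. -/
theorem exists_block_prod_eq_one (A : Subgroup G) [Finite A] (l : List G)
    (hl : ∀ g ∈ l, g ∈ A) (hc : Nat.card A ≤ l.length) :
    ∃ a b c : List G, l = a ++ b ++ c ∧ b ≠ [] ∧ b.prod = 1 := by
  have := Fintype.ofFinite A
  let f : Fin (l.length + 1) → A := fun i =>
    ⟨(l.take i).prod, A.list_prod_mem fun g hg => hl g (List.mem_of_mem_take hg)⟩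
  have hcard : Fintype.card A < Fintype.card (Fin (l.length + 1)) := by
    rw [Fintype.card_fin, ← Nat.card_eq_fintype_card]; omega
  obtain ⟨i, j, hij, hf⟩ := Fintype.exists_ne_map_eq_of_card_lt f hcard
  wlog hlt : i < j generalizing i j
  · exact this j i hij.symm hf.symm (lt_of_le_of_ne (not_lt.1 hlt) hij.symm)
  have hlt' : (i : ℕ) < j := hlt
  have hsplit : l.take j = l.take i ++ (l.take j).drop i := by
    conv_lhs => rw [← List.take_append_drop i (l.take j)]
    rw [List.take_take, min_eq_left hlt'.le]
  refine ⟨l.take i, (l.take j).drop i, l.drop j, ?_, ?_, ?_⟩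
  · rw [← hsplit, List.take_append_drop]
  · intro h
    have := congrArg List.length h
    have hj := j.2
    simp at this
    omega
  · have hp : (l.take i).prod = (l.take j).prod := congrArg Subtype.val hf
    rw [hsplit, List.prod_append] at hp
    simpa using hp

/-- In a product-one ordering of a minimal product-one sequence, a prefix over a subgroup `A`
has at most `|A|` terms. -/
theorem IsMinimalProductOne.length_prefix_le {S : Multiset G} (h : IsMinimalProductOne S)
    (A : Subgroup G) [Finite A] {u v : List G} (hS : S = (u ++ v : List G))
    (hp : (u ++ v).prod = 1) (hu : ∀ g ∈ u, g ∈ A) : u.length ≤ Nat.card A := by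
  by_contra! hlt
  rcases List.eq_nil_or_concat' u with rfl | ⟨w, t, rfl⟩
  · simp at hlt
  obtain ⟨a, b, c, rfl, hb, hb1⟩ := exists_block_prod_eq_one A w
    (fun g hg => hu g (by simp [hg])) (by simp at hlt ⊢; omega)
  refine h.not_split (l₁ := b) (l₂ := a ++ c ++ [t] ++ v) hb (by simp) ?_ hb1 ?_
  · rw [hS, Multiset.coe_eq_coe]
    simp only [List.append_assoc]
    exact List.perm_append_comm_assoc _ _ _
  · simpa [hb1] using hp

theorem prod_eq_prod_filter_mul {A : Set G} [DecidablePred (· ∈ A)]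
    (hA : ∀ g ∈ A, ∀ h, g * h = h * g) (l : List G) :
    l.prod = (l.filter (· ∈ A)).prod * (l.filter (· ∉ A)).prod := by
  induction l with
  | nil => simp
  | cons t l ih =>
    by_cases ht : t ∈ A
    · simp [ht, ih, mul_assoc]
    · have hc : (l.filter (· ∈ A)).prod * t = t * (l.filter (· ∈ A)).prod := by
        have : ∀ m : List G, (∀ g ∈ m, g ∈ A) → m.prod * t = t * m.prod := by
          intro m hm
          induction m with
          | nil => simp
          | cons s m ihm =>
            rw [List.prod_cons, mul_assoc, ihm fun g hg => hm g (by simp [hg]), ← mul_assoc,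
              hA s (hm s (by simp)) t, mul_assoc]
        exact this _ fun g hg => by simpa using (List.mem_filter.1 hg).2
      simp only [List.prod_cons, ht, List.filter_cons, not_false_eq_true, decide_true,
        decide_false, if_true, Bool.false_eq_true, if_false]
      rw [← mul_assoc, hc, mul_assoc, ← ih]

theorem IsMinimalProductOne.card_le_of_mem {S : Multiset G} (h : IsMinimalProductOne S)
    (A : Subgroup G) [Finite A] (hA : ∀ g ∈ S, g ∈ A) : Multiset.card S ≤ Nat.card A := by
  obtain ⟨l, rfl, hl⟩ := h.2.1
  exact h.length_prefix_le A (v := []) (by simp) (by simpa using hl) (by simpa using hA)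

/-- A minimal product-one sequence has at most `|Z|` terms in a central subgroup `Z`. -/
theorem IsMinimalProductOne.card_filter_le {S : Multiset G} (h : IsMinimalProductOne S)
    (Z : Subgroup G) [Finite Z] [DecidablePred (· ∈ Z)] (hZ : ∀ g ∈ Z, ∀ k, g * k = k * g) :
    Multiset.card (S.filter (· ∈ Z)) ≤ Nat.card Z := by
  obtain ⟨l, rfl, hl⟩ := h.2.1
  rw [Multiset.filter_coe, Multiset.coe_card]
  refine h.length_prefix_le Z (v := l.filter (· ∉ Z)) ?_ ?_ ?_
  · rw [Multiset.coe_eq_coe]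
    have := (List.filter_append_perm (· ∈ Z) l).symm
    convert this using 4
    simp
  · rw [List.prod_append, ← hl]
    exact (prod_eq_prod_filter_mul (A := (Z : Set G)) hZ l).symm
  · intro g hg
    simpa using (List.mem_filter.1 hg).2

theorem exists_list_map_eq {α β : Type*} (f : α → β) (L : List β) (s : Multiset α)
    (h : s.map f = L) : ∃ M : List α, (M : Multiset α) = s ∧ M.map f = L := by
  classical
  induction L generalizing s with
  | nil => exact ⟨[], by simpa [eq_comm] using h, rfl⟩
  | cons b L ih =>
    obtain ⟨a, ha, rfl, ht⟩ := (Multiset.map_eq_cons f s L b).2 (by simpa using h)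
    obtain ⟨M, hM, hf⟩ := ih _ ht
    exact ⟨a :: M, by rw [← Multiset.cons_coe, hM, Multiset.cons_erase ha], by simp [hf]⟩

open Classical in
/-- Cut a list at the positions where the partial products, multiplied by `g`, lie in `H`. -/
theorem exists_blocks (H : Subgroup G) (l : List G) (g : G) (n : ℕ)
    (hn : ((Finset.range l.length).filter fun i => g * (l.take i).prod ∈ H).card = n + 1) :
    ∃ (a : List G) (B : List (List G)) (b : List G), l = a ++ B.flatten ++ b ∧ B.length = n ∧
      b ≠ [] ∧ g * a.prod ∈ H ∧ ∀ m ∈ B, m ≠ [] ∧ m.prod ∈ H := by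
  induction l generalizing g n with
  | nil => simp at hn
  | cons t l ih =>
    have key : ((Finset.range (t :: l).length).filter
        fun i => g * ((t :: l).take i).prod ∈ H).card =
        (if g ∈ H then 1 else 0) +
        ((Finset.range l.length).filter fun i => g * t * (l.take i).prod ∈ H).card := by
      simp only [Finset.card_filter, List.length_cons]
      rw [Finset.sum_range_succ', add_comm]
      simp only [List.take_zero, List.prod_nil, mul_one, List.take_succ_cons, List.prod_cons,
        mul_assoc]
      congr 1
    rw [key] at hn
    rcases Nat.eq_zero_or_pos
      ((Finset.range l.length).filter fun i => g * t * (l.take i).prod ∈ H).card with h0 | h0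
    · rw [h0] at hn
      have hg : g ∈ H := by by_contra hg; simp [hg] at hn
      have : n = 0 := by simpa [hg] using hn.symm
      exact ⟨[], [], t :: l, by simp, by simp [this], by simp, by simpa using hg, by simp⟩
    · obtain ⟨k, hk⟩ := Nat.exists_eq_succ_of_ne_zero h0.ne'
      obtain ⟨a, B, b, rfl, hB, hb, ha, hm⟩ := ih (g * t) k hk
      by_cases hg : g ∈ H
      · refine ⟨[], (t :: a) :: B, b, by simp, ?_, hb, by simpa using hg, ?_⟩
        · rw [hk] at hn; simp [hg] at hn; simp [hB]; omega
        · intro m hm'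
          rcases List.mem_cons.1 hm' with rfl | hm'
          · refine ⟨by simp, ?_⟩
            rw [mul_assoc] at ha
            simpa using (H.mul_mem_cancel_left hg).1 ha
          · exact hm m hm'
      · refine ⟨t :: a, B, b, by simp, ?_, hb, by simpa [mul_assoc] using ha, hm⟩
        rw [hk] at hn; simp [hg] at hn; omega

/-- If minimal product-one sequences over a subgroup `H` have at most `M` terms, then those over
`G` have at most `[G : H] * M` terms. -/
theorem card_le_index_mul [Finite G] (H : Subgroup G) (M : ℕ)
    (hM : ∀ T : Multiset H, IsMinimalProductOne T → Multiset.card T ≤ M)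
    (S : Multiset G) (hS : IsMinimalProductOne S) : Multiset.card S ≤ H.index * M := by
  classical
  obtain ⟨l, rfl, hl⟩ := hS.2.1
  by_contra! hlt
  have := Fintype.ofFinite (G ⧸ H)
  obtain ⟨y, -, hy⟩ := Finset.exists_lt_card_fiber_of_mul_lt_card_of_maps_to
    (s := Finset.range l.length) (t := (Finset.univ : Finset (G ⧸ H))) (n := M)
    (f := fun i => ((l.take i).prod : G ⧸ H)) (by simp)
    (by simpa [← Nat.card_eq_fintype_card, Subgroup.index] using hlt)
  obtain ⟨x, rfl⟩ := QuotientGroup.mk_surjective y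
  obtain ⟨n, hn⟩ := Nat.exists_eq_add_of_lt hy
  have hcard : ((Finset.range l.length).filter fun i => x⁻¹ * (l.take i).prod ∈ H).card
      = (M + n) + 1 := by
    rw [← hn]
    congr 1
    ext i
    simp only [Finset.mem_filter, and_congr_right_iff]
    intro _
    rw [eq_comm, QuotientGroup.eq]
  obtain ⟨a, B, b, rfl, hB, hb, ha, hm⟩ := exists_blocks H l x⁻¹ (M + n) hcard
  have hprod : B.flatten.prod * (b ++ a).prod = 1 := by
    simp only [List.prod_append] at hl ⊢
    have : B.flatten.prod * b.prod = a.prod⁻¹ := eq_inv_of_mul_eq_one_right (by rwa [← mul_assoc])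
    rw [← mul_assoc, this, inv_mul_cancel]
  have hBH : B.flatten.prod ∈ H := by
    rw [List.prod_flatten]
    exact H.list_prod_mem (by simpa using fun m h => (hm m h).2)
  have hba : (b ++ a).prod ∈ H := by
    rw [eq_inv_of_mul_eq_one_right hprod]
    exact H.inv_mem hBH
  let C : List {m : List G // m ≠ [] ∧ m.prod ∈ H} :=
    B.pmap (fun m h => ⟨m, h⟩) hm ++ [⟨b ++ a, by simp [hb], hba⟩]
  have hCval : C.map Subtype.val = B ++ [b ++ a] := by
    simp [C, List.map_pmap]
  let f : {m : List G // m ≠ [] ∧ m.prod ∈ H} → H := fun m => ⟨m.1.prod, m.2.2⟩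
  have hfprod : ∀ D : List {m : List G // m ≠ [] ∧ m.prod ∈ H},
      ((D.map f).prod : G) = (D.map Subtype.val).flatten.prod := by
    intro D
    induction D with
    | nil => simp
    | cons d D ih => simp [f]
  have hne : ∀ D : List {m : List G // m ≠ [] ∧ m.prod ∈ H}, D ≠ [] →
      (D.map Subtype.val).flatten ≠ [] := by
    intro D hD h
    rcases D with _ | ⟨d, D⟩
    · exact hD rfl
    · exact d.2.1 (List.append_eq_nil_iff.1 (show d.1 ++ (D.map Subtype.val).flatten = [] from h)).1
  have hT := mt (hM ((C.map f : List H) : Multiset H)) (by simp [C, hB])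
  have hone : (C.map f).prod = 1 := by
    apply Subtype.ext
    rw [hfprod, hCval]
    simpa using hprod
  have hsplit : ∃ T₁ T₂ : Multiset H, T₁ ≠ 0 ∧ T₂ ≠ 0 ∧
      ((C.map f : List H) : Multiset H) = T₁ + T₂ ∧ IsProductOne T₁ ∧ IsProductOne T₂ := by
    by_contra hcon
    exact hT ⟨by simp [C], ⟨_, rfl, hone⟩, hcon⟩
  obtain ⟨T₁, T₂, h₁, h₂, hT12, ⟨L₁, rfl, hL₁⟩, ⟨L₂, rfl, hL₂⟩⟩ := hsplit
  obtain ⟨D, hD, hDf⟩ := exists_list_map_eq f (L₁ ++ L₂) (C : Multiset _) (by simpa using hT12)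
  obtain ⟨D₁, D₂, rfl, rfl, rfl⟩ := List.map_eq_append_iff.1 hDf
  refine hS.not_split (hne D₁ fun h => h₁ (by simp [h])) (hne D₂ fun h => h₂ (by simp [h]))
    ?_ ?_ ?_
  · rw [Multiset.coe_eq_coe, ← List.flatten_append, ← List.map_append]
    have := ((Multiset.coe_eq_coe.1 hD).map Subtype.val).flatten
    refine List.Perm.trans ?_ this.symm
    rw [hCval, List.flatten_append, List.append_assoc]
    refine List.perm_append_comm.trans ?_
    simp
  · rw [← hfprod, hL₁]; rfl
  · rw [← hfprod, hL₂]; rfl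

end General

section ZeroSum

variable {q : ℕ} [Fact q.Prime] {ι : Type*}

open MvPolynomial in
/-- A family of more than `k * (q - 1)` vectors in `(ZMod q) ^ k` has a nonempty zero-sum
subfamily. -/
theorem ZMod.exists_zero_sum_fin {k : ℕ} (a : Fin k → ι → ZMod q) (s : Finset ι)
    (h : k * (q - 1) < s.card) :
    ∃ t ⊆ s, t.Nonempty ∧ ∀ j, ∑ i ∈ t, a j i = 0 := by
  classical
  have hq := (Fact.out : q.Prime)
  have hq1 : q - 1 ≠ 0 := by have := hq.two_le; omega
  let f : Fin k → MvPolynomial s (ZMod q) := fun j => ∑ i : s, a j i • X i ^ (q - 1)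
  have hf : ∑ j, (f j).totalDegree < Fintype.card s := by
    rw [Fintype.card_coe]
    refine lt_of_le_of_lt ?_ h
    calc ∑ j, (f j).totalDegree ≤ ∑ _j : Fin k, (q - 1) := by
          refine Finset.sum_le_sum fun j _ => ?_
          apply totalDegree_finsetSum_le
          rintro i _
          exact (totalDegree_smul_le ..).trans (totalDegree_X_pow ..).le
      _ = k * (q - 1) := by simp
  let zero_sol : {x : s → ZMod q // ∀ j, eval x (f j) = 0} :=
    ⟨0, by simp [f, map_sum, hq1]⟩
  have hdvd := char_dvd_card_solutions_of_fintype_sum_lt q hf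
  obtain ⟨x, hx⟩ := Fintype.exists_ne_of_one_lt_card (hq.one_lt.trans_le <|
    Nat.le_of_dvd (@Fintype.card_pos _ _ ⟨zero_sol⟩)
      (by convert hdvd)) zero_sol
  refine ⟨({a | x.1 a ≠ 0} : Finset _).map ⟨(↑), Subtype.val_injective⟩, ?_, ?_, ?_⟩
  · simp +contextual [Finset.subset_iff]
  · rw [Finset.map_nonempty]
    rw [← Subtype.coe_ne_coe, Function.ne_iff] at hx
    exact hx.imp fun a ha => Finset.mem_filter.2 ⟨Finset.mem_univ _, ha⟩
  · intro j
    simpa [f, ZMod.pow_card_sub_one, Finset.sum_filter] using x.2 j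

/-- Among `3 * q - 2` vectors in `(ZMod q) ^ 2` there is a zero-sum subfamily of between `1` and
`q` vectors. -/
theorem ZMod.exists_short_zero_sum (u v : ι → ZMod q) (s : Finset ι)
    (h : s.card = 3 * q - 2) :
    ∃ t ⊆ s, t.Nonempty ∧ t.card ≤ q ∧ ∑ i ∈ t, u i = 0 ∧ ∑ i ∈ t, v i = 0 := by
  classical
  have hq := (Fact.out : q.Prime).two_le
  obtain ⟨t, hts, htne, ht⟩ := ZMod.exists_zero_sum_fin ![u, v, fun _ => 1] s (by omega)
  have hu : ∑ i ∈ t, u i = 0 := ht 0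
  have hv : ∑ i ∈ t, v i = 0 := ht 1
  have hcard : q ∣ t.card := by
    rw [← CharP.cast_eq_zero_iff (ZMod q)]
    simpa using ht 2
  obtain ⟨m, hm⟩ := hcard
  have hle := Finset.card_le_card hts
  by_cases hm1 : t.card ≤ q
  · exact ⟨t, hts, htne, hm1, hu, hv⟩
  have hm2 : m = 2 := by
    have h1 : 1 < m := by
      by_contra! hcon
      exact hm1 (hm ▸ (Nat.mul_le_mul_left q hcon).trans (by simp))
    have h2 : m < 3 := by
      by_contra! hcon
      have := Nat.mul_le_mul_left q hcon
      omega
    omega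
  subst hm2
  obtain ⟨i, hi⟩ := htne
  have hcard' := Finset.card_erase_of_mem hi
  obtain ⟨r, hrt, hrne, hr⟩ := ZMod.exists_zero_sum_fin ![u, v] (t.erase i) (by omega)
  have hrt' : r ⊆ t := hrt.trans (Finset.erase_subset _ _)
  have hru : ∑ i ∈ r, u i = 0 := hr 0
  have hrv : ∑ i ∈ r, v i = 0 := hr 1
  by_cases hrq : r.card ≤ q
  · exact ⟨r, hrt'.trans hts, hrne, hrq, hru, hrv⟩
  refine ⟨t \ r, Finset.sdiff_subset.trans hts, ⟨i, ?_⟩, ?_, ?_, ?_⟩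
  · exact Finset.mem_sdiff.2 ⟨hi, fun hir => Finset.notMem_erase i t (hrt hir)⟩
  · rw [Finset.card_sdiff_of_subset hrt']; omega
  · have := Finset.sum_sdiff (f := u) hrt'
    rwa [hru, add_zero, hu] at this
  · have := Finset.sum_sdiff (f := v) hrt'
    rwa [hrv, add_zero, hv] at this

theorem Multiset.exists_le_sum_eq_zero {α : Type*} (u v : α → ZMod q) (m : ℕ) (Q : ℕ → Prop)
    (hex : ∀ (u v : ℕ → ZMod q) (s : Finset ℕ), s.card = m →
      ∃ t ⊆ s, t.Nonempty ∧ Q t.card ∧ ∑ i ∈ t, u i = 0 ∧ ∑ i ∈ t, v i = 0)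
    (S : Multiset α) (hm0 : m ≠ 0) (h : m ≤ Multiset.card S) :
    ∃ T ≤ S, T ≠ 0 ∧ Q (Multiset.card T) ∧ (T.map u).sum = 0 ∧ (T.map v).sum = 0 := by
  induction S using Quotient.inductionOn with | _ l
  change m ≤ l.length at h
  have : Nonempty α := ⟨l[0]'(by omega)⟩
  let d : α := Classical.arbitrary α
  obtain ⟨t, hts, hne, ht, hu, hv⟩ := hex (fun i => u (l.getD i d)) (fun i => v (l.getD i d))
    (Finset.range m) (by simp)
  have hl : l = (List.range l.length).map fun i => l.getD i d := by
    apply List.ext_getElem <;> simp +contextual [List.getD]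
  refine ⟨t.val.map fun i => l.getD i d, ?_, by simpa using hne.ne_empty, by simpa using ht,
    ?_, ?_⟩
  · change _ ≤ (l : Multiset α)
    conv_rhs => rw [hl]
    rw [← Multiset.map_coe]
    refine Multiset.map_le_map ?_
    rw [Multiset.coe_range, ← Finset.range_val, Finset.val_le_iff]
    exact hts.trans (Finset.range_subset_range.2 h)
  · rw [Multiset.map_map]; exact hu
  · rw [Multiset.map_map]; exact hv

end ZeroSum

/-- A presentation of a group `H` as a central extension of `(ZMod q) ^ 2`, with coordinates `u`
and `v`, whose commutators are given by the determinant followed by a central embedding `γ` of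
`ZMod q`. -/
structure SymplecticCoordinates (q : ℕ) (H : Type*) [Group H] where
  /-- The embedding of `ZMod q` onto the commutator subgroup. -/
  γ : ZMod q → H
  γ_add : ∀ i j, γ (i + j) = γ i * γ j
  γ_inj : Function.Injective γ
  γ_central : ∀ i h, γ i * h = h * γ i
  /-- The first coordinate. -/
  u : H → ZMod q
  /-- The second coordinate. -/
  v : H → ZMod q
  u_mul : ∀ a b, u (a * b) = u a + u b
  v_mul : ∀ a b, v (a * b) = v a + v b
  mul_comm' : ∀ a b, a * b = b * a * γ (u a * v b - v a * u b)
  surj : ∀ i j, ∃ h, u h = i ∧ v h = j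

namespace SymplecticCoordinates

variable {q : ℕ} {H : Type*} [Group H] (D : SymplecticCoordinates q H)

theorem γ_zero : D.γ 0 = 1 := by simpa using D.γ_add 0 0

theorem u_one : D.u 1 = 0 := by simpa using D.u_mul 1 1

theorem v_one : D.v 1 = 0 := by simpa using D.v_mul 1 1

theorem u_prod (l : List H) : D.u l.prod = (l.map D.u).sum := by
  induction l with
  | nil => simp [u_one]
  | cons t l ih => simp [u_mul, ih]

theorem v_prod (l : List H) : D.v l.prod = (l.map D.v).sum := by
  induction l with
  | nil => simp [v_one]
  | cons t l ih => simp [v_mul, ih]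

/-- The determinant form on coordinates. -/
def form (a b : H) : ZMod q := D.u a * D.v b - D.v a * D.u b

theorem mul_comm_form (a b : H) : a * b = b * a * D.γ (D.form a b) := D.mul_comm' a b

theorem form_mul_right (a b c : H) : D.form a (b * c) = D.form a b + D.form a c := by
  simp only [form, u_mul, v_mul]; ring

theorem form_comm (a b : H) : D.form a b = - D.form b a := by simp only [form]; ring

theorem form_self (a : H) : D.form a a = 0 := by simp only [form]; ring

theorem commute_iff (a b : H) : a * b = b * a ↔ D.form a b = 0 := by
  rw [D.mul_comm_form a b, mul_eq_left, ← D.γ_zero]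
  exact D.γ_inj.eq_iff

/-- The homomorphism to `(ZMod q) ^ 2` given by the coordinates. -/
def coords : H →* Multiplicative (ZMod q × ZMod q) where
  toFun h := .ofAdd (D.u h, D.v h)
  map_one' := by simp [u_one, v_one]
  map_mul' a b := by rw [u_mul, v_mul]; rfl

/-- The kernel of the coordinates, which is the center of `H`. -/
def Z : Subgroup H := D.coords.ker

theorem mem_Z {h : H} : h ∈ D.Z ↔ D.u h = 0 ∧ D.v h = 0 := by
  rw [Z, MonoidHom.mem_ker]
  exact Prod.mk_inj

theorem Z_comm {g : H} (hg : g ∈ D.Z) (k : H) : g * k = k * g := by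
  rw [D.commute_iff, form, (D.mem_Z.1 hg).1, (D.mem_Z.1 hg).2]; ring

theorem mem_Z_of_comm {g : H} (hg : ∀ k, g * k = k * g) : g ∈ D.Z := by
  obtain ⟨a, ha, ha'⟩ := D.surj 1 0
  obtain ⟨b, hb, hb'⟩ := D.surj 0 1
  have h₁ := (D.commute_iff _ _).1 (hg a)
  have h₂ := (D.commute_iff _ _).1 (hg b)
  simp only [form, ha, ha', hb, hb'] at h₁ h₂
  exact D.mem_Z.2 ⟨by simpa using h₂, by simpa using h₁⟩

theorem card_eq : Nat.card H = q ^ 2 * Nat.card D.Z := by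
  have hs : Function.Surjective D.coords := by
    rintro ⟨i, j⟩
    obtain ⟨h, rfl, rfl⟩ := D.surj i j
    exact ⟨h, rfl⟩
  rw [← D.Z.card_mul_index, Z, Subgroup.index_ker, MonoidHom.range_eq_top.2 hs,
    Subgroup.card_top, Nat.card_congr Multiplicative.toAdd, Nat.card_prod, Nat.card_zmod]
  ring

theorem le_card_Z [Finite H] : q ≤ Nat.card D.Z := by
  refine (Nat.card_zmod q).ge.trans (Nat.card_le_card_of_injective
    (fun i => (⟨D.γ i, D.mem_Z_of_comm (D.γ_central i)⟩ : D.Z))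
    fun i j h => D.γ_inj (congrArg Subtype.val h))

variable [Fact q.Prime]

theorem form_trans {P a b : H} (hP : P ∉ D.Z) (ha : D.form P a = 0) (hb : D.form P b = 0) :
    D.form a b = 0 := by
  rw [mem_Z] at hP
  simp only [form] at *
  by_cases h : D.u P = 0
  · have h' : D.v P ≠ 0 := fun h' => hP ⟨h, h'⟩
    apply mul_left_cancel₀ h'
    linear_combination D.v b * ha * (-1) + D.v a * hb
  · apply mul_left_cancel₀ h
    linear_combination D.u a * hb - D.u b * ha

/-- The centralizer of a noncentral element has index `q`. -/
theorem card_centralizer [Finite H] {P : H} (hP : P ∉ D.Z) :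
    Nat.card (Subgroup.centralizer {P}) = q * Nat.card D.Z := by
  let w : H →* Multiplicative (ZMod q) :=
    { toFun := fun h => .ofAdd (D.form P h)
      map_one' := by simp [form, u_one, v_one]
      map_mul' := fun a b => by rw [form_mul_right]; rfl }
  have hw : Function.Surjective w := by
    intro i
    obtain ⟨b, hb⟩ : ∃ b, D.form P b ≠ 0 := by
      by_contra! hcon
      exact hP (D.mem_Z_of_comm fun k => (D.commute_iff _ _).2 (hcon k))
    obtain ⟨c, hc, hc'⟩ := D.surj (D.u b * (D.form P b)⁻¹ * i.toAdd)
      (D.v b * (D.form P b)⁻¹ * i.toAdd)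
    refine ⟨c, Multiplicative.toAdd.injective ?_⟩
    change D.form P c = i.toAdd
    have : D.form P c = D.form P b * (D.form P b)⁻¹ * i.toAdd := by
      conv_lhs => rw [form, hc, hc']
      conv_rhs => rw [form]
      simp only [form]
      ring
    rw [this, mul_inv_cancel₀ hb, one_mul]
  have hker : Subgroup.centralizer {P} = w.ker := by
    ext h
    rw [Subgroup.mem_centralizer_singleton_iff, MonoidHom.mem_ker, eq_comm, D.commute_iff]
    rfl
  have h := w.ker.card_mul_index
  rw [Subgroup.index_ker, MonoidHom.range_eq_top.2 hw, Subgroup.card_top,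
    Nat.card_congr Multiplicative.toAdd, Nat.card_zmod, D.card_eq, ← hker] at h
  have hq := (Fact.out : q.Prime).pos
  apply Nat.eq_of_mul_eq_mul_right hq
  rw [h]; ring

theorem exists_central_blocks [Finite H] (n : ℕ) (hn : 1 ≤ n) (S : Multiset H)
    (hS : q * n + q - 1 ≤ Multiset.card S) :
    ∃ B : List (List H), B.length = n ∧ (B.flatten : Multiset H) ≤ S ∧
      ∀ m ∈ B, m ≠ [] ∧ m.prod ∈ D.Z := by
  have hq := (Fact.out : q.Prime).two_le
  induction n, hn using Nat.le_induction generalizing S with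
  | base =>
    obtain ⟨T, hT, hT0, -, hu, hv⟩ := Multiset.exists_le_sum_eq_zero D.u D.v (2 * q - 1)
      (fun _ => True) (fun u v s hs => by
        obtain ⟨t, hts, hne, ht⟩ := ZMod.exists_zero_sum_fin ![u, v] s (by omega)
        exact ⟨t, hts, hne, trivial, ht 0, ht 1⟩) S (by omega) (by omega)
    induction T using Quotient.inductionOn with | _ l
    refine ⟨[l], rfl, by simpa using hT, ?_⟩
    simp only [List.mem_singleton, forall_eq]
    exact ⟨by simpa using hT0, D.mem_Z.2 ⟨(D.u_prod l).trans (by simpa using hu),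
      (D.v_prod l).trans (by simpa using hv)⟩⟩
  | succ n hn ih =>
    have hn' : q * 1 ≤ q * n := Nat.mul_le_mul_left q hn
    rw [mul_add] at hS
    obtain ⟨T, hT, hT0, hTq, hu, hv⟩ := Multiset.exists_le_sum_eq_zero D.u D.v (3 * q - 2)
      (fun m => m ≤ q) (fun u v s hs => ZMod.exists_short_zero_sum u v s hs) S (by omega)
      (by omega)
    obtain ⟨R, rfl⟩ := Multiset.le_iff_exists_add.1 hT
    rw [Multiset.card_add] at hS
    obtain ⟨B, hB, hBR, hBm⟩ := ih R (by omega)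
    induction T using Quotient.inductionOn with | _ l
    refine ⟨l :: B, by simp [hB], ?_, ?_⟩
    · rw [List.flatten_cons, ← Multiset.coe_add]
      exact add_le_add_right hBR _
    · intro m hm
      rcases List.mem_cons.1 hm with rfl | hm
      · exact ⟨by simpa using hT0, D.mem_Z.2 ⟨(D.u_prod _).trans (by simpa using hu),
          (D.v_prod _).trans (by simpa using hv)⟩⟩
      · exact hBm m hm

/-- The bound `q * |Z| + q - 2` for the small Davenport constant of `H`. -/
theorem exists_prod_eq_one [Finite H] (S : Multiset H)
    (hS : q * Nat.card D.Z + q - 1 ≤ Multiset.card S) :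
    ∃ l : List H, l ≠ [] ∧ (l : Multiset H) ≤ S ∧ l.prod = 1 := by
  obtain ⟨B, hB, hBS, hm⟩ := D.exists_central_blocks _ Nat.card_pos S hS
  obtain ⟨a, b, c, habc, hb, hb1⟩ := exists_block_prod_eq_one D.Z (B.map List.prod)
    (by simpa using fun m h => (hm m h).2) (by simp [hB])
  obtain ⟨a, c, rfl, hab, rfl⟩ := List.map_eq_append_iff.1 habc
  obtain ⟨a, b, rfl, rfl, rfl⟩ := List.map_eq_append_iff.1 hab
  refine ⟨b.flatten, ?_, ?_, by rw [List.prod_flatten, hb1]⟩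
  · rcases b with _ | ⟨m, b⟩
    · simp at hb
    · intro h
      exact (hm m (by simp)).1 (List.append_eq_nil_iff.1 (List.flatten_cons ▸ h)).1
  · refine le_trans ?_ hBS
    simp only [List.flatten_append, ← Multiset.coe_add]
    exact (Multiset.le_add_left _ _).trans (Multiset.le_add_right _ _)

/-- Lists in which each term fails to commute with the product of the terms after it, the last
term being noncentral. -/
inductive Spreading (D : SymplecticCoordinates q H) : List H → Prop
  | single (t : H) (ht : t ∉ D.Z) : Spreading D [t]
  | cons (t : H) (l : List H) (hl : Spreading D l) (ht : D.form t l.prod ≠ 0) :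
      Spreading D (t :: l)

theorem Spreading.prod_notMem {D : SymplecticCoordinates q H} {l : List H} (h : D.Spreading l) :
    l.prod ∉ D.Z := by
  cases h with
  | single t ht => simpa using ht
  | cons t l hl ht =>
    intro hmem
    have := (D.commute_iff _ _).1 (D.Z_comm hmem t)
    rw [List.prod_cons, form_comm, form_mul_right, form_self, zero_add, neg_eq_zero] at this
    exact ht this

theorem exists_prod_perm_eq {l l' : List H} (h : l.Perm l') :
    ∃ e, l.prod = l'.prod * D.γ e := by
  induction h with
  | nil => exact ⟨0, by simp [γ_zero]⟩
  | cons x _ ih =>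
    obtain ⟨e, he⟩ := ih
    exact ⟨e, by simp [he, mul_assoc]⟩
  | swap x y l =>
    refine ⟨D.form y x, ?_⟩
    simp only [List.prod_cons, ← mul_assoc]
    rw [D.mul_comm_form y x, mul_assoc, D.γ_central, ← mul_assoc]
  | trans _ _ ih₁ ih₂ =>
    obtain ⟨e₁, h₁⟩ := ih₁
    obtain ⟨e₂, h₂⟩ := ih₂
    exact ⟨e₂ + e₁, by rw [h₁, h₂, γ_add, mul_assoc]⟩

open Classical Pointwise in
theorem Spreading.le_card_prods {D : SymplecticCoordinates q H} {l : List H}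
    (h : D.Spreading l) :
    min q l.length ≤ (Finset.univ.filter fun e : ZMod q =>
      ∃ l' : List H, l'.Perm l ∧ l'.prod = l.prod * D.γ e).card := by
  induction h with
  | single t ht =>
    refine (min_le_right _ _).trans (Finset.card_pos.2 ⟨0, ?_⟩)
    simp only [Finset.mem_filter, Finset.mem_univ, true_and]
    exact ⟨[t], List.Perm.refl _, by simp [γ_zero]⟩
  | cons t l hl ht ih =>
    set E := Finset.univ.filter fun e : ZMod q =>
      ∃ l' : List H, l'.Perm l ∧ l'.prod = l.prod * D.γ e
    have hE : E.Nonempty := by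
      refine ⟨0, ?_⟩
      simp only [E, Finset.mem_filter, Finset.mem_univ, true_and]
      exact ⟨l, List.Perm.refl _, by simp [γ_zero]⟩
    have hb : D.form l.prod t ≠ 0 := by rw [form_comm]; exact neg_ne_zero.2 ht
    have hcd := ZMod.cauchy_davenport (Fact.out : q.Prime) hE
      (Finset.insert_nonempty 0 {D.form l.prod t})
    rw [Finset.card_pair hb.symm] at hcd
    refine le_trans ?_ (hcd.trans (Finset.card_le_card ?_))
    · rw [List.length_cons]; omega
    · intro i hi
      obtain ⟨e, he, b, hb, rfl⟩ := Finset.mem_add.1 hi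
      simp only [E, Finset.mem_filter, Finset.mem_univ, true_and] at he ⊢
      obtain ⟨l', hl', hp⟩ := he
      rcases Finset.mem_insert.1 hb with rfl | hb
      · exact ⟨t :: l', hl'.cons t, by simp [hp, mul_assoc]⟩
      · rw [Finset.mem_singleton.1 hb]
        refine ⟨l' ++ [t], (List.perm_append_singleton t l').trans (hl'.cons t), ?_⟩
        rw [List.prod_append, List.prod_singleton, hp, mul_assoc, D.γ_central, ← mul_assoc,
          D.mul_comm_form l.prod t, List.prod_cons, mul_assoc, ← γ_add, add_comm]

theorem Spreading.exists_perm_prod_eq {D : SymplecticCoordinates q H} {l : List H}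
    (h : D.Spreading l) (hl : l.length = q) (e : ZMod q) :
    ∃ l' : List H, l'.Perm l ∧ l'.prod = l.prod * D.γ e := by
  classical
  have hc := h.le_card_prods
  rw [hl, min_self] at hc
  have h := (Finset.card_eq_iff_eq_univ (α := ZMod q) _).1
    (le_antisymm (Finset.card_le_univ _) (by rwa [ZMod.card]))
  have he := Finset.mem_univ e
  rw [← h] at he
  exact (Finset.mem_filter.1 he).2

theorem card_le_of_spreading [Finite H] {S : Multiset H} (hS : IsMinimalProductOne S)
    {l : List H} (h : D.Spreading l) (hl : l.length = q) (hlS : (l : Multiset H) ≤ S) :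
    Multiset.card S ≤ q * Nat.card D.Z + 2 * q - 2 := by
  have hq := (Fact.out : q.Prime).two_le
  by_contra! hlt
  obtain ⟨R, rfl⟩ := Multiset.le_iff_exists_add.1 hlS
  rw [Multiset.card_add, Multiset.coe_card, hl] at hlt
  obtain ⟨w, hw, hwR, hw1⟩ := D.exists_prod_eq_one R (by omega)
  obtain ⟨W, rfl⟩ := Multiset.le_iff_exists_add.1 hwR
  obtain ⟨r, rfl⟩ := Quotient.exists_rep W
  obtain ⟨s, hs, hs1⟩ := hS.2.1
  have hperm : s.Perm (l ++ r ++ w) := by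
    rw [← Multiset.coe_eq_coe, hs, ← Multiset.coe_add, ← Multiset.coe_add, add_assoc,
      add_comm (r : Multiset H)]
    rfl
  obtain ⟨e, he⟩ := D.exists_prod_perm_eq hperm
  obtain ⟨l', hl', hp⟩ := h.exists_perm_prod_eq hl e
  refine hS.not_split (l₁ := w) (l₂ := l' ++ r) hw ?_ ?_ hw1 ?_
  · intro hcon
    have := hl'.length_eq
    rw [(List.append_eq_nil_iff.1 hcon).1, List.length_nil] at this
    omega
  · rw [← hs, Multiset.coe_eq_coe]
    refine hperm.trans (List.perm_append_comm.trans ?_)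
    exact (List.Perm.append_right r hl'.symm).append_left w
  · rw [List.prod_append, List.prod_append, hw1, mul_one, hs1] at he
    rw [List.prod_append, hp, mul_assoc, D.γ_central, ← mul_assoc, he]

theorem spreading_append {P x : H} (hP : P ∉ D.Z) (hx : D.form P x ≠ 0) (l : List H)
    (hl : ∀ z ∈ l, z ∉ D.Z ∧ D.form P z = 0) : D.Spreading (l ++ [x]) := by
  induction l with
  | nil =>
    refine .single x fun hmem => hx ?_
    rw [form_comm, neg_eq_zero]
    exact (D.commute_iff _ _).1 (D.Z_comm hmem P)
  | cons z l ih =>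
    have ih := ih fun y hy => hl y (by simp [hy])
    obtain ⟨hz, hPz⟩ := hl z (by simp)
    refine .cons z _ ih ?_
    have hPl : D.form P l.prod = 0 := by
      rw [← D.commute_iff, ← Subgroup.mem_centralizer_singleton_iff.trans eq_comm]
      refine Subgroup.list_prod_mem _ fun y hy => ?_
      rw [Subgroup.mem_centralizer_singleton_iff, eq_comm, D.commute_iff]
      exact (hl y (by simp [hy])).2
    change D.form z (l ++ [x]).prod ≠ 0
    rw [List.prod_append, List.prod_singleton, form_mul_right, D.form_trans hP hPz hPl, zero_add]
    intro hzx
    exact hx (D.form_trans hz (by rw [form_comm, hPz, neg_zero]) hzx)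

/-- A minimal product-one sequence over `H` has at most `q * |Z| + 2 * q - 2` terms. -/
theorem card_le [Finite H] {S : Multiset H} (hS : IsMinimalProductOne S) :
    Multiset.card S ≤ q * Nat.card D.Z + 2 * q - 2 := by
  classical
  have hq := (Fact.out : q.Prime).two_le
  have hZ : Nat.card D.Z ≤ q * Nat.card D.Z := Nat.le_mul_of_pos_left _ (by omega)
  by_contra! hlt
  have key : ∀ k, 1 ≤ k → k ≤ q →
      ∃ l : List H, D.Spreading l ∧ l.length = k ∧ (l : Multiset H) ≤ S := by
    intro k hk
    induction k, hk using Nat.le_induction with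
    | base =>
      intro _
      by_contra! hcon
      have := hS.card_le_of_mem D.Z fun g hg => by
        by_contra hgZ
        exact hcon [g] (.single g hgZ) rfl (by simpa using hg)
      omega
    | succ k hk ih =>
      intro hkq
      obtain ⟨l, hl, hlk, hlS⟩ := ih (by omega)
      obtain ⟨R, rfl⟩ := Multiset.le_iff_exists_add.1 hlS
      by_cases hR : ∃ t ∈ R, D.form t l.prod ≠ 0
      · obtain ⟨t, htR, ht⟩ := hR
        refine ⟨t :: l, .cons t l hl ht, by simp [hlk], ?_⟩
        rw [← Multiset.cons_coe, ← Multiset.singleton_add, add_comm]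
        exact add_le_add_right (Multiset.singleton_le.2 htR) _
      push Not at hR
      by_cases hx : ∃ x ∈ l, D.form l.prod x ≠ 0
      · obtain ⟨x, hxl, hx⟩ := hx
        exfalso
        by_cases hcard : q - 1 ≤ Multiset.card (R.filter (· ∉ D.Z))
        · obtain ⟨m, hTq, hT⟩ : ∃ m : List H, m.length = q - 1 ∧
              (m : Multiset H) ≤ R.filter (· ∉ D.Z) := by
            obtain ⟨m, hm⟩ := Quotient.exists_rep (R.filter (· ∉ D.Z))
            rw [← hm] at hcard ⊢
            exact ⟨m.take (q - 1), by simpa using hcard, (List.take_sublist _ _).subperm⟩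
          have hsp := D.spreading_append hl.prod_notMem hx m fun z hz => by
            have hz' := Multiset.mem_filter.1 (Multiset.mem_of_le hT (by exact hz))
            exact ⟨hz'.2, by rw [form_comm, hR z hz'.1, neg_zero]⟩
          have := D.card_le_of_spreading hS hsp (by simp; omega) (by
            rw [← Multiset.coe_add, add_comm]
            exact add_le_add (by simpa using hxl) (hT.trans (Multiset.filter_le _ _)))
          omega
        · have h₁ := hS.card_filter_le D.Z fun g hg k => D.Z_comm hg k
          have h₂ : Multiset.card (R.filter (· ∈ D.Z)) ≤
              Multiset.card (((l : Multiset H) + R).filter (· ∈ D.Z)) :=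
            Multiset.card_le_card (Multiset.filter_le_filter _ (Multiset.le_add_left _ _))
          have h₃ := congrArg Multiset.card (Multiset.filter_add_not (· ∈ D.Z) R)
          rw [Multiset.card_add] at h₃
          rw [Multiset.card_add, Multiset.coe_card] at hlt
          omega
      · push Not at hx
        have := hS.card_le_of_mem (Subgroup.centralizer {l.prod}) fun g hg => by
          rw [Subgroup.mem_centralizer_singleton_iff, D.commute_iff]
          rcases Multiset.mem_add.1 hg with hg | hg
          · rw [form_comm, hx g (by simpa using hg), neg_zero]
          · exact hR g hg
        rw [D.card_centralizer hl.prod_notMem] at this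
        omega
  obtain ⟨l, hl, hlq, hlS⟩ := key q (by omega) le_rfl
  have := D.card_le_of_spreading hS hl hlq hlS
  omega

end SymplecticCoordinates

section Nilpotent

variable {G : Type*} [Group G]

open scoped commutatorElement

/-- A finite nonabelian nilpotent group contains elements `x` and `y` with a central commutator of
prime order. -/
theorem exists_commutator_central_prime_order [Finite G] (hnil : Group.IsNilpotent G)
    (hna : ¬ ∀ a b : G, a * b = b * a) :
    ∃ (q : ℕ) (x y c : G), q.Prime ∧ orderOf c = q ∧ c ∈ Subgroup.center G ∧
      x * y = y * x * c := by
  have hnt : Nontrivial (G ⧸ Subgroup.center G) := by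
    rw [QuotientGroup.nontrivial_iff]
    intro htop
    refine hna fun a b => ?_
    have : a ∈ Subgroup.center G := htop ▸ Subgroup.mem_top a
    exact (Subgroup.mem_center_iff.1 this b).symm
  have hbot := Group.IsNilpotent.center_ne_bot (G := G ⧸ Subgroup.center G)
  have hc1 : Nat.card (Subgroup.center (G ⧸ Subgroup.center G)) ≠ 1 := by
    rwa [Ne, Subgroup.card_eq_one]
  obtain ⟨q, hq, hqd⟩ := Nat.exists_prime_and_dvd hc1
  have := Fact.mk hq
  obtain ⟨⟨z, hz⟩, hzq⟩ := exists_prime_orderOf_dvd_card' q hqd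
  obtain ⟨x, rfl⟩ := QuotientGroup.mk_surjective z
  rw [Subgroup.orderOf_mk] at hzq
  have hxZ : x ∉ Subgroup.center G := by
    intro h
    rw [(QuotientGroup.eq_one_iff x).2 h, orderOf_one] at hzq
    exact hq.one_lt.ne hzq
  have hxq : x ^ q ∈ Subgroup.center G := by
    rw [← QuotientGroup.eq_one_iff, QuotientGroup.mk_pow, ← hzq, pow_orderOf_eq_one]
  obtain ⟨y, hy⟩ : ∃ y, x * y ≠ y * x := by
    by_contra! hcon
    exact hxZ (Subgroup.mem_center_iff.2 fun g => (hcon g).symm)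
  obtain ⟨c, hc⟩ : ∃ c, x * y = y * x * c := ⟨(y * x)⁻¹ * (x * y), by group⟩
  have hcZ : c ∈ Subgroup.center G := by
    rw [← QuotientGroup.eq_one_iff]
    have h₁ := congrArg (QuotientGroup.mk (s := Subgroup.center G)) hc
    simp only [QuotientGroup.mk_mul] at h₁
    rw [← Subgroup.mem_center_iff.1 hz (y : G ⧸ Subgroup.center G)] at h₁
    exact mul_eq_left.1 h₁.symm
  have hcomm := Subgroup.mem_center_iff.1 hcZ
  have hpow : ∀ n : ℕ, x ^ n * y = y * x ^ n * c ^ n := by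
    intro n
    induction n with
    | zero => simp
    | succ n ih =>
      calc x ^ (n + 1) * y = x ^ n * (x * y) := by rw [pow_succ, mul_assoc]
        _ = x ^ n * y * (x * c) := by rw [hc]; simp only [mul_assoc]
        _ = y * x ^ n * (c ^ n * x) * c := by rw [ih]; simp only [mul_assoc]
        _ = y * x ^ n * (x * c ^ n) * c := by
          rw [Subgroup.mem_center_iff.1 (Subgroup.pow_mem _ hcZ n) x]
        _ = y * x ^ (n + 1) * c ^ (n + 1) := by simp only [pow_succ, mul_assoc]
  refine ⟨q, x, y, c, hq, orderOf_eq_prime ?_ ?_, hcZ, hc⟩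
  · have h := hpow q
    rw [← Subgroup.mem_center_iff.1 hxq y] at h
    exact mul_eq_left.1 h.symm
  · rintro rfl
    exact hy (by simpa using hc)

/-- The subgroup generated by two elements with a central commutator of prime order has
symplectic coordinates. -/
theorem nonempty_symplecticCoordinates {q : ℕ} (hq : q.Prime) {x y c : G}
    (hcq : orderOf c = q) (hcZ : c ∈ Subgroup.center G) (hc : x * y = y * x * c) :
    Nonempty (SymplecticCoordinates q (Subgroup.closure {x, y})) := by
  have := Fact.mk hq
  let γ : ZMod q → G := fun i => c ^ i.val
  have γ_add : ∀ i j, γ (i + j) = γ i * γ j := fun i j => by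
    simp only [γ, ZMod.val_add, ← pow_add]
    have := pow_mod_orderOf c (i.val + j.val)
    rwa [hcq] at this
  have γ_inj : Function.Injective γ := fun i j h => by
    refine ZMod.val_injective q (pow_injOn_Iio_orderOf ?_ ?_ h)
    · simpa [hcq] using ZMod.val_lt i
    · simpa [hcq] using ZMod.val_lt j
  have γ_central : ∀ i h, γ i * h = h * γ i := fun i h =>
    (Subgroup.mem_center_iff.1 (Subgroup.pow_mem _ hcZ _) h).symm
  have γ_zero : γ 0 = 1 := by simpa using γ_add 0 0
  have γ_one : γ 1 = c := by
    have := Fact.mk hq.one_lt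
    simp [γ, ZMod.val_one]
  have mul_left : ∀ a a' b i j, a * b = b * a * γ i → a' * b = b * a' * γ j →
      a * a' * b = b * (a * a') * γ (i + j) := fun a a' b i j h h' => by
    rw [mul_assoc, h', ← mul_assoc, ← mul_assoc, h, γ_add, mul_assoc _ (γ i), γ_central i a',
      mul_assoc, mul_assoc, mul_assoc, mul_assoc]
    simp only [mul_assoc]
  have symm : ∀ a b i, a * b = b * a * γ i → b * a = a * b * γ (-i) := fun a b i h => by
    rw [h, mul_assoc, ← γ_add, add_neg_cancel, γ_zero, mul_one]
  have mul_right : ∀ a b b' i j, a * b = b * a * γ i → a * b' = b' * a * γ j →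
      a * (b * b') = b * b' * a * γ (i + j) := fun a b b' i j h h' => by
    have := symm _ _ _ (mul_left b b' a _ _ (symm _ _ _ h) (symm _ _ _ h'))
    rwa [show -(-i + -j) = i + j by ring] at this
  have inv_left : ∀ a b i, a * b = b * a * γ i → a⁻¹ * b = b * a⁻¹ * γ (-i) :=
    fun a b i h => by
    have h' := symm _ _ _ h
    rw [inv_mul_eq_iff_eq_mul, ← mul_assoc, ← mul_assoc, h, mul_assoc _ (γ i), γ_central i a⁻¹,
      mul_assoc _ _ (γ (-i)), mul_assoc _ _ (γ (-i)), ← γ_add, add_neg_cancel, γ_zero]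
    group
  have inv_right : ∀ a b i, a * b = b * a * γ i → a * b⁻¹ = b⁻¹ * a * γ (-i) :=
    fun a b i h => by
    have := symm _ _ _ (inv_left b a _ (symm _ _ _ h))
    rwa [neg_neg] at this
  have uniq : ∀ a b i j, a * b = b * a * γ i → a * b = b * a * γ j → i = j :=
    fun a b i j h h' => γ_inj (mul_left_cancel (h.symm.trans h'))
  have hex : ∀ a b : Subgroup.closure {x, y}, ∃ i, (a : G) * b = b * a * γ i := by
    rintro ⟨a, ha⟩ ⟨b, hb⟩
    induction ha, hb using Subgroup.closure_induction₂ with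
    | mem a b ha hb =>
      rcases ha with rfl | rfl <;> rcases hb with rfl | rfl
      · exact ⟨0, by simp [γ_zero]⟩
      · exact ⟨1, by simpa [γ_one] using hc⟩
      · exact ⟨-1, symm _ _ _ (by simpa [γ_one] using hc)⟩
      · exact ⟨0, by simp [γ_zero]⟩
    | one_left => exact ⟨0, by simp [γ_zero]⟩
    | one_right => exact ⟨0, by simp [γ_zero]⟩
    | mul_left a a' b _ _ _ h h' =>
      obtain ⟨i, hi⟩ := h
      obtain ⟨j, hj⟩ := h'
      exact ⟨_, mul_left _ _ _ _ _ hi hj⟩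
    | mul_right b b' a _ _ _ h h' =>
      obtain ⟨i, hi⟩ := h
      obtain ⟨j, hj⟩ := h'
      exact ⟨_, mul_right _ _ _ _ _ hi hj⟩
    | inv_left a b _ _ h =>
      obtain ⟨i, hi⟩ := h
      exact ⟨_, inv_left _ _ _ hi⟩
    | inv_right a b _ _ h =>
      obtain ⟨i, hi⟩ := h
      exact ⟨_, inv_right _ _ _ hi⟩
  choose f hf using hex
  let X : Subgroup.closure {x, y} := ⟨x, Subgroup.subset_closure (by simp)⟩
  let Y : Subgroup.closure {x, y} := ⟨y, Subgroup.subset_closure (by simp)⟩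
  have f_left : ∀ a a' b, f (a * a') b = f a b + f a' b := fun a a' b =>
    uniq _ _ _ _ (hf (a * a') b) (mul_left _ _ _ _ _ (hf a b) (hf a' b))
  have f_right : ∀ a b b', f a (b * b') = f a b + f a b' := fun a b b' =>
    uniq _ _ _ _ (hf a (b * b')) (mul_right _ _ _ _ _ (hf a b) (hf a b'))
  have f_XX : f X X = 0 := uniq _ _ _ _ (hf X X) (by simp [γ_zero])
  have f_YY : f Y Y = 0 := uniq _ _ _ _ (hf Y Y) (by simp [γ_zero])
  have h_XY : (X : G) * Y = Y * X * γ 1 := by rw [γ_one]; exact hc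
  have f_XY : f X Y = 1 := uniq _ _ _ _ (hf X Y) h_XY
  have f_YX : f Y X = -1 := uniq _ _ _ _ (hf Y X) (symm _ _ _ h_XY)
  have f_one : ∀ b, f 1 b = 0 := fun b => by simpa using f_left 1 1 b
  have f_one' : ∀ b, f b 1 = 0 := fun b => by simpa using f_right b 1 1
  have f_pow : ∀ a b (n : ℕ), f a (b ^ n) = n * f a b := fun a b n => by
    induction n with
    | zero => rw [pow_zero, f_one']; simp
    | succ n ih => rw [pow_succ, f_right, ih]; push_cast; ring
  have f_inv : ∀ a b, f a⁻¹ b = - f a b := fun a b =>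
    uniq _ _ _ _ (hf a⁻¹ b) (inv_left _ _ _ (hf a b))
  have f_inv' : ∀ a b, f a b⁻¹ = - f a b := fun a b =>
    uniq _ _ _ _ (hf a b⁻¹) (inv_right _ _ _ (hf a b))
  have f_det : ∀ a b, f a b = f X a * f Y b - f Y a * f X b := by
    rintro ⟨a, ha⟩ b
    induction ha using Subgroup.closure_induction with
    | mem a ha =>
      rcases ha with rfl | rfl
      · change f X b = f X X * f Y b - f Y X * f X b
        rw [f_XX, f_YX]; ring
      · change f Y b = f X Y * f Y b - f Y Y * f X b
        rw [f_XY, f_YY]; ring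
    | one =>
      change f 1 b = f X 1 * f Y b - f Y 1 * f X b
      rw [f_one, f_one', f_one']; ring
    | mul a a' ha ha' h h' =>
      change f (⟨a, ha⟩ * ⟨a', ha'⟩) b =
        f X (⟨a, ha⟩ * ⟨a', ha'⟩) * f Y b - f Y (⟨a, ha⟩ * ⟨a', ha'⟩) * f X b
      rw [f_left, f_right, f_right, h, h']; ring
    | inv a ha h =>
      change f (⟨a, ha⟩⁻¹) b = f X (⟨a, ha⟩⁻¹) * f Y b - f Y (⟨a, ha⟩⁻¹) * f X b
      rw [f_inv, f_inv', f_inv', h]; ring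
  have c_mem : c ∈ Subgroup.closure {x, y} := by
    rw [eq_inv_mul_of_mul_eq hc.symm]
    exact mul_mem (inv_mem (Y * X).2) (X * Y).2
  exact ⟨{
    γ := fun i => ⟨γ i, Subgroup.pow_mem _ c_mem _⟩
    γ_add := fun i j => Subtype.ext (γ_add i j)
    γ_inj := fun i j h => γ_inj (congrArg Subtype.val h)
    γ_central := fun i h => Subtype.ext (γ_central i h)
    u := f X
    v := f Y
    u_mul := f_right X
    v_mul := f_right Y
    mul_comm' := fun a b => Subtype.ext (by rw [← f_det]; exact hf a b)
    surj := fun i j => ⟨Y ^ i.val * X ^ (-j).val, by simp [f_right, f_pow, f_XY, f_XX],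
      by simp [f_right, f_pow, f_YX, f_YY]⟩ }⟩

end Nilpotent

theorem sq_add_mul_cube_le {p q : ℕ} (hp : 2 ≤ p) (hpq : p ≤ q) :
    p ^ 3 * (q ^ 2 + 2 * q - 2) ≤ (p ^ 2 + 2 * p - 2) * q ^ 3 := by
  obtain ⟨k, rfl⟩ := Nat.exists_eq_add_of_le hpq
  obtain ⟨m, rfl⟩ := Nat.exists_eq_add_of_le hp
  have h₁ : (2 + m + k) ^ 2 + 2 * (2 + m + k) - 2 = (2 + m + k) ^ 2 + 2 * (1 + m + k) := by omega
  have h₂ : (2 + m) ^ 2 + 2 * (2 + m) - 2 = (2 + m) ^ 2 + 2 * (1 + m) := by omega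
  rw [h₁, h₂]
  zify
  rw [← sub_nonneg]
  ring_nf
  positivity

theorem stmt5 (G : Type*) [Group G] [Finite G]
    (hnil : Group.IsNilpotent G)
    (hna : ¬ ∀ a b : G, a * b = b * a)
    (p : ℕ) (hp : p = (Nat.card G).minFac) :
    p ^ 3 * largeDavenport G ≤ (p ^ 2 + 2 * p - 2) * Nat.card G := by
  obtain ⟨q, x, y, c, hq, hcq, hcZ, hc⟩ := exists_commutator_central_prime_order hnil hna
  have : Fact q.Prime := ⟨hq⟩
  obtain ⟨D⟩ := nonempty_symplecticCoordinates hq hcq hcZ hc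
  set H := Subgroup.closure {x, y}
  have hpq : p ≤ q := hp ▸ Nat.minFac_le_of_dvd hq.two_le (hcq ▸ orderOf_dvd_natCard c)
  have hp2 : 2 ≤ p := by
    refine hp ▸ (Nat.minFac_prime fun h ↦ hna ?_).two_le
    have := (Nat.card_eq_one_iff_unique.mp h).1
    exact fun a b ↦ Subsingleton.elim _ _
  have hbound : largeDavenport G ≤ H.index * (q * Nat.card D.Z + 2 * q - 2) := by
    refine csSup_le' ?_
    rintro _ ⟨S, rfl, hS⟩
    exact card_le_index_mul H _ (fun T hT ↦ D.card_le hT) S hS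
  rw [← Subgroup.card_mul_index H, D.card_eq]
  have hz := D.le_card_Z
  generalize Nat.card D.Z = z at hbound hz ⊢
  have hstep : q * (q * z + 2 * q - 2) ≤ (q ^ 2 + 2 * q - 2) * z := by
    obtain ⟨r, rfl⟩ := Nat.exists_eq_add_of_le hq.two_le
    have h₁ : (2 + r) * z + 2 * (2 + r) - 2 = (2 + r) * z + 2 * (1 + r) := by omega
    have h₂ : (2 + r) ^ 2 + 2 * (2 + r) - 2 = (2 + r) ^ 2 + 2 * (1 + r) := by omega
    rw [h₁, h₂]
    nlinarith [Nat.mul_le_mul_left (1 + r) hz]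
  have hcancel : p ^ 3 * (q * z + 2 * q - 2) ≤ (p ^ 2 + 2 * p - 2) * (q ^ 2 * z) := by
    refine Nat.le_of_mul_le_mul_left ?_ hq.pos
    calc q * (p ^ 3 * (q * z + 2 * q - 2)) = p ^ 3 * (q * (q * z + 2 * q - 2)) := by ring
      _ ≤ p ^ 3 * ((q ^ 2 + 2 * q - 2) * z) := Nat.mul_le_mul_left _ hstep
      _ = p ^ 3 * (q ^ 2 + 2 * q - 2) * z := by ring
      _ ≤ (p ^ 2 + 2 * p - 2) * q ^ 3 * z := Nat.mul_le_mul_right _ (sq_add_mul_cube_le hp2 hpq)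
      _ = q * ((p ^ 2 + 2 * p - 2) * (q ^ 2 * z)) := by ring
  calc p ^ 3 * largeDavenport G ≤ p ^ 3 * (H.index * (q * z + 2 * q - 2)) :=
        Nat.mul_le_mul_left _ hbound
    _ = p ^ 3 * (q * z + 2 * q - 2) * H.index := by ring
    _ ≤ (p ^ 2 + 2 * p - 2) * (q ^ 2 * z) * H.index := Nat.mul_le_mul_right _ hcancel
    _ = (p ^ 2 + 2 * p - 2) * (q ^ 2 * z * H.index) := by ring
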